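/- Let ε > 0 and x, y ∈ ℝ² be such that the four points 0, y, x, x+y are distinct and at pairwise Euclidean distances greater than 2ε, and let F : ℝ² → ℝ be F = (1/(2ε²))·( 𝟙_{B_ε(0)} + 𝟙_{B_ε(y)} − 𝟙_{B_ε(x)} − 𝟙_{B_ε(x+y)} ). Then (z,z') ↦ F(z)F(z')·log|z−z'| is Lebesgue-integrable on ℝ² × ℝ², and (1/(2π²)) · ∬_{ℝ²×ℝ²} F(z)F(z') log|z−z'| dz dz' = (1/2)log ε + (1/2)log|y| − (1/2)log|x| − (1/4)log|x−y| − (1/4)log|x+y| + 4b₀ + 4b_ε(y) − 4b_ε(x) − 2b_ε(x+y) − 2b_ε(x−y), where b₀ := (1/(8π²)) ∬_{B_1(0)×B_1(0)} log|z−z'| dz dz' and, for w ∈ ℝ² ∖ {0}, b_ε(w) := (1/(8π²)) ∬_{B_1(0)×B_1(0)} log( |w + ε(z−z')| / |w| ) dz dz'. In particular the exponential of the left-hand side equals a_ε(x,y) · ε^{1/2} · ( |y|² / (|x|²·|x−y|·|x+y|) )^{1/4} with a_ε(x,y) := exp(4b₀ + 4b_ε(y) − 4b_ε(x) − 2b_ε(x+y)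 − 2b_ε(x−y)). -/

import Mathlib

open Filter Topology MeasureTheory

namespace GFF

/-- The Euclidean plane `ℝ²`. -/
abbrev Plane : Type := EuclideanSpace ℝ (Fin 2)

/-- `b₀ = (1/(8π²)) ∬_{B_1(0)×B_1(0)} log|z-z'| dz dz'`. -/
noncomputable def b0 : ℝ :=
  (1 / (8 * Real.pi ^ 2)) *
    ∫ z in Metric.closedBall (0 : Plane) 1,
      ∫ z' in Metric.closedBall (0 : Plane) 1, Real.log ‖z - z'‖

/-- `b_ε(x) = (1/(8π²)) ∬_{B_1(0)×B_1(0)} log(|x + ε(z-z')|/|x|) dz dz'`. -/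
noncomputable def beps (ε : ℝ) (x : Plane) : ℝ :=
  (1 / (8 * Real.pi ^ 2)) *
    ∫ z in Metric.closedBall (0 : Plane) 1,
      ∫ z' in Metric.closedBall (0 : Plane) 1, Real.log (‖x + ε • (z - z')‖ / ‖x‖)

end GFF

namespace GFF

/-- The four-point test function
`F = (1/(2ε²))(𝟙_{B_ε(0)} + 𝟙_{B_ε(y)} - 𝟙_{B_ε(x)} - 𝟙_{B_ε(x+y)})`. -/
noncomputable def Ffour (ε : ℝ) (x y : Plane) (z : Plane) : ℝ :=
  (1 / (2 * ε ^ 2)) *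
    ((Metric.closedBall (0 : Plane) ε).indicator (fun _ => (1 : ℝ)) z +
      (Metric.closedBall y ε).indicator (fun _ => (1 : ℝ)) z -
      (Metric.closedBall x ε).indicator (fun _ => (1 : ℝ)) z -
      (Metric.closedBall (x + y) ε).indicator (fun _ => (1 : ℝ)) z)

/-- The logarithmic kernel restricted to `B_ε(a) × B_ε(b)`. -/
noncomputable def ballLog (ε : ℝ) (a b : Plane) (p : Plane × Plane) : ℝ :=
  (Metric.closedBall a ε).indicator (fun _ => (1 : ℝ)) p.1 *
    (Metric.closedBall b ε).indicator (fun _ => (1 : ℝ)) p.2 * Real.log ‖p.1 - p.2‖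

/-- The integral of `log|w + ε(u-u')|` over pairs of points of the unit ball. -/
noncomputable def unitBallLog (ε : ℝ) (w : Plane) : ℝ :=
  ∫ u in Metric.closedBall (0 : Plane) 1,
    ∫ u' in Metric.closedBall (0 : Plane) 1, Real.log ‖w + ε • (u - u')‖

lemma integrableOn_log_norm_ball (R : ℝ) :
    IntegrableOn (fun v : Plane => Real.log ‖v‖) (Metric.ball 0 R) := by
  rw [integrableOn_fun_norm_addHaar volume (f := Real.log)]
  have h : IntegrableOn Real.log (Set.Ioo 0 R) := by
    rcases le_or_gt R 0 with hR | hR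
    · simp [Set.Ioo_eq_empty_of_le hR]
    · exact (intervalIntegral.intervalIntegrable_log' (a := 0) (b := R)).1.mono_set
        Set.Ioo_subset_Ioc_self
  refine Integrable.bdd_mul (c := |R|) h (by fun_prop) ?_
  filter_upwards [ae_restrict_mem measurableSet_Ioo] with t ht
  have : Module.finrank ℝ Plane - 1 = 1 := by simp
  rw [this, pow_one, Real.norm_eq_abs, abs_of_pos ht.1]
  exact ht.2.le.trans (le_abs_self R)

lemma integrable_ballLog (ε : ℝ) (a b : Plane) : Integrable (ballLog ε a b) := by
  set R : ℝ := ε + ε + ‖a - b‖ + 1 with hR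
  have h1 : Integrable ((Metric.closedBall a ε).indicator (fun _ => (1 : ℝ))) := by
    rw [integrable_indicator_iff Metric.isClosed_closedBall.measurableSet]
    exact integrableOn_const (isCompact_closedBall a ε).measure_ne_top
  have h2 : Integrable ((Metric.ball (0 : Plane) R).indicator (fun v => Real.log ‖v‖)) :=
    (integrable_indicator_iff measurableSet_ball).2 (integrableOn_log_norm_ball R)
  have h3 := (measurePreserving_prod_sub (volume : Measure Plane)
    volume).integrable_comp_of_integrable
    (h1.mul_prod h2)
  have h4 : Integrable (fun p : Plane × Plane =>
      (Metric.closedBall b ε).indicator (fun _ => (1 : ℝ)) p.2 *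
        ((Metric.closedBall a ε).indicator (fun _ => (1 : ℝ)) p.1 *
          (Metric.ball (0 : Plane) R).indicator (fun v => Real.log ‖v‖) (p.2 - p.1))) := by
    refine Integrable.bdd_mul (c := 1) h3 ?_ ?_
    · exact ((measurable_const.indicator
        Metric.isClosed_closedBall.measurableSet).comp measurable_snd).aestronglyMeasurable
    · refine Eventually.of_forall fun p => ?_
      by_cases h : p.2 ∈ Metric.closedBall b ε <;> simp [h]
  refine h4.congr (Eventually.of_forall fun p => ?_)
  by_cases hb : p.2 ∈ Metric.closedBall b ε
  · by_cases ha : p.1 ∈ Metric.closedBall a ε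
    · have hm : p.2 - p.1 ∈ Metric.ball (0 : Plane) R := by
        rw [mem_closedBall_iff_norm] at ha hb
        rw [mem_ball_zero_iff]
        have e : p.2 - p.1 = (p.2 - b) - (p.1 - a) - (a - b) := by abel
        have t1 := norm_sub_le ((p.2 - b) - (p.1 - a)) (a - b)
        have t2 := norm_sub_le (p.2 - b) (p.1 - a)
        rw [e]
        linarith
      simp only [ballLog, Set.indicator_of_mem hb, Set.indicator_of_mem ha,
        Set.indicator_of_mem hm, norm_sub_rev p.2 p.1]
      ring
    · simp [ballLog, ha]
  · simp [ballLog, hb]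

lemma integral_eq_integral_add_smul (f : Plane → ℝ) (a : Plane) {ε : ℝ} (hε : 0 < ε) :
    ∫ z, f z = ε ^ 2 * ∫ u, f (a + ε • u) := by
  rw [Measure.integral_comp_smul volume (fun v => f (a + v)) ε,
    integral_add_left_eq_self f a, finrank_euclideanSpace_fin, abs_of_pos (by positivity),
    smul_eq_mul]
  field_simp

lemma indicator_closedBall_add_smul (a u : Plane) {ε : ℝ} (hε : 0 < ε) :
    (Metric.closedBall a ε).indicator (fun _ => (1 : ℝ)) (a + ε • u) =
      (Metric.closedBall (0 : Plane) 1).indicator (fun _ => (1 : ℝ)) u := by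
  have h : a + ε • u ∈ Metric.closedBall a ε ↔ u ∈ Metric.closedBall (0 : Plane) 1 := by
    simp [norm_smul, abs_of_pos hε, hε]
  by_cases hu : u ∈ Metric.closedBall (0 : Plane) 1
  · rw [Set.indicator_of_mem hu, Set.indicator_of_mem (h.2 hu)]
  · rw [Set.indicator_of_notMem hu, Set.indicator_of_notMem (mt h.1 hu)]

lemma integral_ballLog {ε : ℝ} (hε : 0 < ε) (a b : Plane) :
    ∫ p, ballLog ε a b p = ε ^ 4 * unitBallLog ε (a - b) := by
  have hm : MeasurableSet (Metric.closedBall (0 : Plane) 1) :=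
    Metric.isClosed_closedBall.measurableSet
  rw [Measure.volume_eq_prod, integral_prod _ (integrable_ballLog ε a b),
    integral_eq_integral_add_smul _ a hε]
  simp_rw [fun u : Plane => integral_eq_integral_add_smul
    (fun z' => ballLog ε a b (a + ε • u, z')) b hε]
  rw [integral_const_mul, ← mul_assoc, unitBallLog, ← integral_indicator hm]
  congr 1
  · ring
  · refine integral_congr_ae (Eventually.of_forall fun u => ?_)
    simp only [ballLog, indicator_closedBall_add_smul _ _ hε]
    by_cases hu : u ∈ Metric.closedBall (0 : Plane) 1
    · rw [Set.indicator_of_mem hu, Set.indicator_of_mem hu, ← integral_indicator hm]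
      refine integral_congr_ae (Eventually.of_forall fun u' => ?_)
      have e : a + ε • u - (b + ε • u') = a - b + ε • (u - u') := by
        rw [smul_sub]; abel
      by_cases hu' : u' ∈ Metric.closedBall (0 : Plane) 1
      · simp only [Set.indicator_of_mem hu', e, one_mul]
      · simp only [Set.indicator_of_notMem hu', mul_zero, zero_mul]
    · simp only [Set.indicator_of_notMem hu, zero_mul, integral_zero]

lemma unitBallLog_neg {ε : ℝ} (hε : 0 < ε) (w : Plane) :
    unitBallLog ε (-w) = unitBallLog ε w := by
  have h1 := integral_ballLog hε 0 w
  have h2 := integral_ballLog hε w 0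
  have h3 : ∫ p, ballLog ε 0 w p = ∫ p, ballLog ε w 0 p := by
    rw [Measure.volume_eq_prod, ← integral_prod_swap]
    refine integral_congr_ae (Eventually.of_forall fun p => ?_)
    simp only [ballLog, Prod.fst_swap, Prod.snd_swap, norm_sub_rev p.2 p.1]
    ring
  rw [zero_sub] at h1
  rw [sub_zero] at h2
  have h4 : ε ^ 4 ≠ 0 := by positivity
  exact mul_left_cancel₀ h4 (by rw [← h1, ← h2, h3])

lemma volume_real_closedBall_one : volume.real (Metric.closedBall (0 : Plane) 1) = Real.pi := by
  simp [Measure.real, EuclideanSpace.volume_closedBall_fin_two, Real.pi_nonneg]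

lemma integral_integral_const_add (c : ℝ) {f : Plane × Plane → ℝ}
    (hf : IntegrableOn f (Metric.closedBall (0 : Plane) 1 ×ˢ Metric.closedBall (0 : Plane) 1)) :
    ∫ u in Metric.closedBall (0 : Plane) 1, ∫ u' in Metric.closedBall (0 : Plane) 1,
        (c + f (u, u')) =
      Real.pi ^ 2 * c + ∫ u in Metric.closedBall (0 : Plane) 1,
        ∫ u' in Metric.closedBall (0 : Plane) 1, f (u, u') := by
  set B := Metric.closedBall (0 : Plane) 1
  have hB : volume B ≠ ⊤ := (isCompact_closedBall (0 : Plane) 1).measure_ne_top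
  have hc : IntegrableOn (fun _ : Plane × Plane => c) (B ×ˢ B) :=
    integrableOn_const ((isCompact_closedBall (0 : Plane) 1).prod
      (isCompact_closedBall (0 : Plane) 1)).measure_ne_top
  rw [Measure.volume_eq_prod] at hf hc
  have e1 := setIntegral_prod _ (hc.add hf)
  have e2 := setIntegral_prod _ hf
  have e3 := setIntegral_prod _ hc
  rw [← e2]
  simp only [Pi.add_apply] at e1
  rw [← e1, integral_add hc hf, e3]
  simp only [setIntegral_const, B, volume_real_closedBall_one, smul_eq_mul]
  ring

lemma unitBallLog_of_lt_norm {ε : ℝ} (hε : 0 < ε) {w : Plane} (hw : 2 * ε < ‖w‖) :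
    unitBallLog ε w = Real.pi ^ 2 * Real.log ‖w‖ + 8 * Real.pi ^ 2 * beps ε w := by
  set B := Metric.closedBall (0 : Plane) 1 with hB
  have hw0 : 0 < ‖w‖ := by linarith
  have hne : ∀ u ∈ B, ∀ u' ∈ B, ‖w + ε • (u - u')‖ ≠ 0 := by
    intro u hu u' hu'
    rw [hB, mem_closedBall_zero_iff] at hu hu'
    have h1 : ‖ε • (u - u')‖ ≤ 2 * ε := by
      rw [norm_smul, Real.norm_eq_abs, abs_of_pos hε]
      nlinarith [norm_sub_le u u']
    have h2 := norm_sub_le_norm_add w (ε • (u - u'))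
    linarith
  have hm : MeasurableSet B := Metric.isClosed_closedBall.measurableSet
  have hi : IntegrableOn (fun p : Plane × Plane => Real.log (‖w + ε • (p.1 - p.2)‖ / ‖w‖))
      (B ×ˢ B) := by
    refine ContinuousOn.integrableOn_compact
      ((isCompact_closedBall _ _).prod (isCompact_closedBall _ _)) ?_
    refine ContinuousOn.log (by fun_prop) ?_
    intro p hp
    exact div_ne_zero (hne _ hp.1 _ hp.2) hw0.ne'
  have h := integral_integral_const_add (Real.log ‖w‖) hi
  have e : unitBallLog ε w = ∫ u in B, ∫ u' in B,
      (Real.log ‖w‖ + Real.log (‖w + ε • (u - u')‖ / ‖w‖)) := by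
    refine setIntegral_congr_fun hm fun u hu => setIntegral_congr_fun hm fun u' hu' => ?_
    simp only [Real.log_div (hne u hu u' hu') hw0.ne']
    ring
  rw [e, h, beps]
  have := Real.pi_ne_zero
  field_simp

lemma unitBallLog_zero {ε : ℝ} (hε : 0 < ε) :
    unitBallLog ε 0 = Real.pi ^ 2 * Real.log ε + 8 * Real.pi ^ 2 * b0 := by
  set B := Metric.closedBall (0 : Plane) 1 with hB
  have hm : MeasurableSet B := Metric.isClosed_closedBall.measurableSet
  have hi : IntegrableOn (fun p : Plane × Plane => Real.log ‖p.1 - p.2‖) (B ×ˢ B) := by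
    rw [← integrable_indicator_iff (hm.prod hm)]
    refine (integrable_ballLog 1 0 0).congr (Eventually.of_forall fun p => ?_)
    by_cases h1 : p.1 ∈ B <;> by_cases h2 : p.2 ∈ B <;>
      simp [ballLog, ← hB, Set.indicator, h1, h2]
  have h := integral_integral_const_add (Real.log ε) hi
  have e : unitBallLog ε 0 = ∫ u in B, ∫ u' in B, (Real.log ε + Real.log ‖u - u'‖) := by
    refine setIntegral_congr_fun hm fun u _ => integral_congr_ae (ae_restrict_of_ae ?_)
    filter_upwards [Measure.ae_ne volume u] with u' hu'
    have : ‖u - u'‖ ≠ 0 := norm_ne_zero_iff.2 (sub_ne_zero.2 hu'.symm)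
    rw [zero_add, norm_smul, Real.norm_eq_abs, abs_of_pos hε, Real.log_mul hε.ne' this]
  rw [e, h, b0]
  have := Real.pi_ne_zero
  field_simp

lemma Ffour_mul_Ffour_mul_log (ε : ℝ) (x y : Plane) (p : Plane × Plane) :
    Ffour ε x y p.1 * Ffour ε x y p.2 * Real.log ‖p.1 - p.2‖ =
      ∑ i : Fin 4, ∑ j : Fin 4, ((1 / (2 * ε ^ 2)) ^ 2 *
        ((![1, 1, -1, -1] : Fin 4 → ℝ) i * (![1, 1, -1, -1] : Fin 4 → ℝ) j)) *
          ballLog ε (![0, y, x, x + y] i) (![0, y, x, x + y] j) p := by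
  simp only [Fin.sum_univ_four, Ffour, ballLog]
  simp
  ring

/-- The GFF variance functional for the four-point observable. The four points
`0, y, x, x+y` are pairwise at distance greater than `2ε` (hence distinct). -/
theorem gff_four_point (ε : ℝ) (hε : 0 < ε) (x y : Plane)
    (hx : 2 * ε < ‖x‖) (hy : 2 * ε < ‖y‖)
    (hxy : 2 * ε < ‖x + y‖) (hxy' : 2 * ε < ‖x - y‖) :
    Integrable (fun p : Plane × Plane =>
      Ffour ε x y p.1 * Ffour ε x y p.2 * Real.log ‖p.1 - p.2‖) ∧
    (1 / (2 * Real.pi ^ 2)) *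
        (∫ p : Plane × Plane, Ffour ε x y p.1 * Ffour ε x y p.2 * Real.log ‖p.1 - p.2‖) =
      (1 / 2) * Real.log ε + (1 / 2) * Real.log ‖y‖ - (1 / 2) * Real.log ‖x‖ -
        (1 / 4) * Real.log ‖x - y‖ - (1 / 4) * Real.log ‖x + y‖ +
        4 * b0 + 4 * beps ε y - 4 * beps ε x - 2 * beps ε (x + y) - 2 * beps ε (x - y) ∧
    Real.exp ((1 / (2 * Real.pi ^ 2)) *
        (∫ p : Plane × Plane, Ffour ε x y p.1 * Ffour ε x y p.2 * Real.log ‖p.1 - p.2‖)) =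
      Real.exp (4 * b0 + 4 * beps ε y - 4 * beps ε x -
          2 * beps ε (x + y) - 2 * beps ε (x - y)) *
        ε ^ ((1 : ℝ) / 2) *
        (‖y‖ ^ 2 / (‖x‖ ^ 2 * ‖x - y‖ * ‖x + y‖)) ^ ((1 : ℝ) / 4) := by
  have hfun : (fun p : Plane × Plane =>
      Ffour ε x y p.1 * Ffour ε x y p.2 * Real.log ‖p.1 - p.2‖) = fun p =>
      ∑ i : Fin 4, ∑ j : Fin 4, ((1 / (2 * ε ^ 2)) ^ 2 *
        ((![1, 1, -1, -1] : Fin 4 → ℝ) i * (![1, 1, -1, -1] : Fin 4 → ℝ) j)) *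
          ballLog ε (![0, y, x, x + y] i) (![0, y, x, x + y] j) p :=
    funext (Ffour_mul_Ffour_mul_log ε x y)
  have hint : ∀ i j : Fin 4, Integrable fun p => ((1 / (2 * ε ^ 2)) ^ 2 *
        ((![1, 1, -1, -1] : Fin 4 → ℝ) i * (![1, 1, -1, -1] : Fin 4 → ℝ) j)) *
          ballLog ε (![0, y, x, x + y] i) (![0, y, x, x + y] j) p :=
    fun i j => (integrable_ballLog ε _ _).const_mul _
  have hvalue : (1 / (2 * Real.pi ^ 2)) *
        (∫ p : Plane × Plane, Ffour ε x y p.1 * Ffour ε x y p.2 * Real.log ‖p.1 - p.2‖) =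
      (1 / 2) * Real.log ε + (1 / 2) * Real.log ‖y‖ - (1 / 2) * Real.log ‖x‖ -
        (1 / 4) * Real.log ‖x - y‖ - (1 / 4) * Real.log ‖x + y‖ +
        4 * b0 + 4 * beps ε y - 4 * beps ε x - 2 * beps ε (x + y) - 2 * beps ε (x - y) := by
    rw [hfun, integral_finsetSum _ fun i _ => integrable_finsetSum _ fun j _ => hint i j]
    simp_rw [integral_finsetSum _ fun j _ => hint _ j, integral_const_mul, integral_ballLog hε]
    simp only [Fin.sum_univ_four, Matrix.cons_val, sub_self, zero_sub, sub_zero,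
      add_sub_cancel_left, add_sub_cancel_right, sub_add_cancel_left, sub_add_cancel_right]
    have hyx : unitBallLog ε (y - x) = unitBallLog ε (x - y) := by
      rw [← neg_sub, unitBallLog_neg hε]
    rw [hyx]
    simp only [unitBallLog_neg hε, unitBallLog_zero hε, unitBallLog_of_lt_norm hε hx,
      unitBallLog_of_lt_norm hε hy, unitBallLog_of_lt_norm hε hxy,
      unitBallLog_of_lt_norm hε hxy']
    have := Real.pi_ne_zero
    have := hε.ne'
    field_simp
    ring
  refine ⟨?_, hvalue, ?_⟩
  · rw [hfun]
    exact integrable_finsetSum _ fun i _ => integrable_finsetSum _ fun j _ => hint i j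
  · have px : 0 < ‖x‖ := by linarith
    have py : 0 < ‖y‖ := by linarith
    have pxy : 0 < ‖x + y‖ := by linarith
    have pxy' : 0 < ‖x - y‖ := by linarith
    rw [hvalue, Real.rpow_def_of_pos hε, Real.rpow_def_of_pos (by positivity),
      Real.log_div (by positivity) (by positivity), Real.log_mul (by positivity) (by positivity),
      Real.log_mul (by positivity) (by positivity), Real.log_pow, Real.log_pow,
      ← Real.exp_add, ← Real.exp_add]
    congr 1
    push_cast
    ring

end GFF
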